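/- arXiv:1412.4724 — 3 statements merged into one kernel-verified Lean document; each statement's English description precedes it below -/
import Mathlib

section
/- Let a, b ∈ [−1,1]. The maximum of ⟨AB⟩ over all probability measures μ on {−1,1}² ⊆ ℝ² satisfying ⟨A⟩ = a and ⟨B⟩ = b equals 1 − |a − b|; that is, every such μ satisfies ⟨AB⟩ ≤ 1 − |a − b|, and there exists such a μ with ⟨AB⟩ = 1 − |a − b|. -/
open MeasureTheory

/-- `μ` is a probability measure on `ℝ × ℝ` concentrated on the finite set `{−1,1}²`. -/
def IsSignProb2 (μ : Measure (ℝ × ℝ)) : Prop :=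
  IsProbabilityMeasure μ ∧
    μ {p : ℝ × ℝ | ¬ ((p.1 = 1 ∨ p.1 = -1) ∧ (p.2 = 1 ∨ p.2 = -1))} = 0

/-- The four-atom measure with masses `p, q, r, s` at `(1,1), (1,-1), (-1,1), (-1,-1)`. -/
noncomputable def signMeasure (p q r s : ℝ) : Measure (ℝ × ℝ) :=
  (ENNReal.ofReal p • Measure.dirac (1, 1) + ENNReal.ofReal q • Measure.dirac (1, -1)) +
    (ENNReal.ofReal r • Measure.dirac (-1, 1) + ENNReal.ofReal s • Measure.dirac (-1, -1))

lemma integral_signMeasure {p q r s : ℝ} (hp : 0 ≤ p) (hq : 0 ≤ q) (hr : 0 ≤ r) (hs : 0 ≤ s)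
    (f : ℝ × ℝ → ℝ) :
    ∫ x, f x ∂signMeasure p q r s =
      p * f (1, 1) + q * f (1, -1) + (r * f (-1, 1) + s * f (-1, -1)) := by
  have h (c : ℝ) (x : ℝ × ℝ) : Integrable f (ENNReal.ofReal c • Measure.dirac x) :=
    (integrable_dirac (by simp)).smul_measure ENNReal.ofReal_ne_top
  rw [signMeasure, integral_add_measure ((h _ _).add_measure (h _ _))
      ((h _ _).add_measure (h _ _)),
    integral_add_measure (h _ _) (h _ _), integral_add_measure (h _ _) (h _ _)]
  simp [integral_smul_measure, ENNReal.toReal_ofReal, hp, hq, hr, hs]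

lemma isSignProb2_signMeasure {p q r s : ℝ} (hp : 0 ≤ p) (hq : 0 ≤ q) (hr : 0 ≤ r)
    (hs : 0 ≤ s) (h : p + q + (r + s) = 1) : IsSignProb2 (signMeasure p q r s) := by
  refine ⟨⟨?_⟩, ?_⟩
  · simp only [signMeasure, Measure.add_apply, Measure.smul_apply, measure_univ, smul_eq_mul,
      mul_one]
    rw [← ENNReal.ofReal_add hp hq, ← ENNReal.ofReal_add hr hs,
      ← ENNReal.ofReal_add (by positivity) (by positivity), h, ENNReal.ofReal_one]
  · simp [signMeasure, Measure.dirac_apply]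

lemma IsSignProb2.ae_mem {μ : Measure (ℝ × ℝ)} (hμ : IsSignProb2 μ) :
    ∀ᵐ x ∂μ, (x.1 = 1 ∨ x.1 = -1) ∧ (x.2 = 1 ∨ x.2 = -1) :=
  ae_iff.2 hμ.2

lemma IsSignProb2.integral_mul_le {μ : Measure (ℝ × ℝ)} (hμ : IsSignProb2 μ) :
    ∫ x, x.1 * x.2 ∂μ ≤ 1 - |∫ x, x.1 ∂μ - ∫ x, x.2 ∂μ| := by
  have := hμ.1
  have integrable_of_abs_le_one {f : ℝ × ℝ → ℝ} (hf : Measurable f)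
      (h : ∀ᵐ x ∂μ, |f x| ≤ 1) : Integrable f μ :=
    .of_bound hf.aestronglyMeasurable 1 h
  have h₁ : Integrable (fun x : ℝ × ℝ => x.1) μ := integrable_of_abs_le_one measurable_fst <| by
    filter_upwards [hμ.ae_mem] with x hx
    rcases hx.1 with h | h <;> simp [h]
  have h₂ : Integrable (fun x : ℝ × ℝ => x.2) μ := integrable_of_abs_le_one measurable_snd <| by
    filter_upwards [hμ.ae_mem] with x hx
    rcases hx.2 with h | h <;> simp [h]
  have h₁₂ : ∫ x, x.1 * x.2 ∂μ = ∫ x, (1 - |x.1 - x.2|) ∂μ := by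
    refine integral_congr_ae ?_
    filter_upwards [hμ.ae_mem] with x ⟨h, h'⟩
    rcases h with h | h <;> rcases h' with h' | h' <;> norm_num [h, h']
  have h_abs : Integrable (fun x : ℝ × ℝ => |x.1 - x.2|) μ := (h₁.sub h₂).abs
  rw [h₁₂, integral_sub (integrable_const _) h_abs, ← integral_sub h₁ h₂]
  simpa only [integral_const, probReal_univ, one_smul] using
    sub_le_sub_left abs_integral_le_integral_abs 1

theorem stmt3 (a b : ℝ) (ha : -1 ≤ a ∧ a ≤ 1) (hb : -1 ≤ b ∧ b ≤ 1) :
    (∀ μ : Measure (ℝ × ℝ), IsSignProb2 μ →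
        (∫ p, p.1 ∂μ) = a → (∫ p, p.2 ∂μ) = b →
        (∫ p, p.1 * p.2 ∂μ) ≤ 1 - |a - b|) ∧
      (∃ μ : Measure (ℝ × ℝ), IsSignProb2 μ ∧
        (∫ p, p.1 ∂μ) = a ∧ (∫ p, p.2 ∂μ) = b ∧
        (∫ p, p.1 * p.2 ∂μ) = 1 - |a - b|) := by
  refine ⟨fun μ hμ h₁ h₂ => h₁ ▸ h₂ ▸ hμ.integral_mul_le, ?_⟩
  have hp : 0 ≤ (1 + min a b) / 2 := by linarith [le_min ha.1 hb.1]
  have hq : 0 ≤ (a - min a b) / 2 := by linarith [min_le_left a b]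
  have hr : 0 ≤ (b - min a b) / 2 := by linarith [min_le_right a b]
  have hs : 0 ≤ (1 - max a b) / 2 := by linarith [max_le ha.2 hb.2]
  have hadd := min_add_max a b
  have hsub := max_sub_min_eq_abs' a b
  refine ⟨_, isSignProb2_signMeasure hp hq hr hs (by linarith), ?_, ?_, ?_⟩ <;>
    rw [integral_signMeasure hp hq hr hs] <;> linarith
end

section
/- Let n ≥ 3 and let v₁,…,vₙ and c₁,…,cₙ be reals, with indices taken cyclically (so index n+1 means 1). There exists a probability measure μ on {−1,1}ⁿ ⊆ ℝⁿ with ⟨Aᵢ⟩ = vᵢ and ⟨AᵢAᵢ₊₁⟩ = cᵢ for all i = 1,…,n if and only if for every i one has −1 ≤ vᵢ ≤ 1 and |vᵢ + vᵢ₊₁| − 1 ≤ cᵢ ≤ 1 − |vᵢ − vᵢ₊₁|, and moreover s₁(c₁,…,cₙ) ≤ n − 2. -/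
open MeasureTheory

/-- `s₁(x₁,…,xₖ)`: the maximum of `∑ ιᵢ xᵢ` over sign vectors `ι ∈ {−1,1}ᵏ`
with an odd number of `−1`'s (equivalently, `∏ ιᵢ = −1`). -/
noncomputable def s1 {k : ℕ} (x : Fin k → ℝ) : ℝ :=
  sSup {y | ∃ ι : Fin k → ℝ, (∀ i, ι i = 1 ∨ ι i = -1) ∧ (∏ i, ι i) = -1 ∧ y = ∑ i, ι i * x i}

/-- `μ` is a probability measure on `Fin n → ℝ` concentrated on the finite set `{−1,1}ⁿ`. -/
def IsSignProb {n : ℕ} (μ : Measure (Fin n → ℝ)) : Prop :=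
  IsProbabilityMeasure μ ∧ μ {A : Fin n → ℝ | ¬ ∀ i, A i = 1 ∨ A i = -1} = 0

/-! ### Finite models of a path of sign variables with prescribed correlations -/

/-- A finite probability space carrying `±1`-valued variables `X 0, …, X k` with means `v i`,
consecutive correlations `c i`, and correlation `d` between `X 0` and `X k`. -/
def HasPathModel (k : ℕ) (v c : ℕ → ℝ) (d : ℝ) : Prop :=
  ∃ (Ω : Type) (_ : Fintype Ω) (p : Ω → ℝ) (X : ℕ → Ω → ℝ),
    (∀ ω, 0 ≤ p ω) ∧ ∑ ω, p ω = 1 ∧ (∀ i ω, X i ω = 1 ∨ X i ω = -1) ∧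
    (∀ i ≤ k, ∑ ω, p ω * X i ω = v i) ∧
    (∀ i < k, ∑ ω, p ω * (X i ω * X (i + 1) ω) = c i) ∧
    ∑ ω, p ω * (X 0 ω * X k ω) = d

/-- The largest value of `∑ ιᵢ cᵢ` over `i ≤ k` among sign vectors with product `1` (first
component) and with product `-1` (second component). -/
noncomputable def maxSignedSum (c : ℕ → ℝ) : ℕ → ℝ × ℝ
  | 0 => (c 0, -c 0)
  | k + 1 =>
    (max ((maxSignedSum c k).1 + c (k + 1)) ((maxSignedSum c k).2 - c (k + 1)),
     max ((maxSignedSum c k).2 + c (k + 1)) ((maxSignedSum c k).1 - c (k + 1)))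

/-- The constraints on the correlation `c` of two sign variables with means `a` and `b`. -/
def PairBound (a b c : ℝ) : Prop := |a + b| - 1 ≤ c ∧ c ≤ 1 - |a - b|

lemma pairBound_iff {a b c : ℝ} : PairBound a b c ↔
    0 ≤ 1 + a + b + c ∧ 0 ≤ 1 + a - b - c ∧ 0 ≤ 1 - a + b - c ∧ 0 ≤ 1 - a - b + c := by
  have h1 : |a + b| - 1 ≤ c ↔ |a + b| ≤ c + 1 := sub_le_iff_le_add
  have h2 : c ≤ 1 - |a - b| ↔ |a - b| ≤ 1 - c := le_sub_comm
  rw [PairBound, h1, h2, abs_le, abs_le]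
  constructor
  · rintro ⟨⟨_, _⟩, _, _⟩
    refine ⟨?_, ?_, ?_, ?_⟩ <;> linarith
  · rintro ⟨_, _, _, _⟩
    refine ⟨⟨?_, ?_⟩, ?_, ?_⟩ <;> linarith

lemma maxSignedSum_bounds {k : ℕ} {v c : ℕ → ℝ}
    (hc : ∀ i ≤ k, PairBound (v i) (v (i + 1)) (c i)) :
    (maxSignedSum c k).1 ≤ (k + 1) - |v 0 - v (k + 1)| ∧
    (maxSignedSum c k).2 ≤ (k + 1) - |v 0 + v (k + 1)| ∧
    (maxSignedSum c k).1 + (maxSignedSum c k).2 ≤ 2 * k := by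
  induction k with
  | zero =>
    have := hc 0 le_rfl
    unfold PairBound at this
    simp only [maxSignedSum, Nat.cast_zero, zero_add] at this ⊢
    refine ⟨?_, ?_, ?_⟩ <;> linarith
  | succ k ih =>
    obtain ⟨h1, h2, h3⟩ := ih fun i hi => hc i (by omega)
    have h := hc (k + 1) le_rfl
    unfold PairBound at h
    obtain ⟨h4, h5⟩ := h
    simp only [maxSignedSum]
    push_cast
    generalize (maxSignedSum c k).1 = P at *
    generalize (maxSignedSum c k).2 = N at *
    generalize v 0 = a at *
    generalize v (k + 1) = b at *
    generalize v (k + 1 + 1) = e at *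
    have t1 : |a - e| ≤ |a - b| + |b - e| := abs_sub_le _ _ _
    have t2 : |a - e| ≤ |a + b| + |b + e| := by
      have := abs_sub_le a (-b) e
      rwa [sub_neg_eq_add, show -b - e = -(b + e) by ring, abs_neg] at this
    have t3 : |a + e| ≤ |a + b| + |b - e| := by
      have := abs_sub_le a (-b) (-e)
      rwa [sub_neg_eq_add, sub_neg_eq_add, show -b - -e = -(b - e) by ring, abs_neg] at this
    have t4 : |a + e| ≤ |a - b| + |b + e| := by
      have := abs_sub_le a b (-e)
      rwa [sub_neg_eq_add, sub_neg_eq_add] at this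
    have := abs_nonneg (a - b)
    have := abs_nonneg (a + b)
    have := abs_nonneg (b - e)
    have := abs_nonneg (b + e)
    refine ⟨max_le ?_ ?_, max_le ?_ ?_, ?_⟩
    · linarith
    · linarith
    · linarith
    · linarith
    · rcases max_choice (P + c (k + 1)) (N - c (k + 1)) with h | h <;>
      rcases max_choice (N + c (k + 1)) (P - c (k + 1)) with h' | h' <;>
      rw [h, h'] <;> linarith

lemma exists_signs_eq_maxSignedSum (c : ℕ → ℝ) (k : ℕ) :
    (∃ ι : ℕ → ℝ, (∀ i, ι i = 1 ∨ ι i = -1) ∧ ∏ i ∈ Finset.range (k + 1), ι i = 1 ∧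
      ∑ i ∈ Finset.range (k + 1), ι i * c i = (maxSignedSum c k).1) ∧
    (∃ ι : ℕ → ℝ, (∀ i, ι i = 1 ∨ ι i = -1) ∧ ∏ i ∈ Finset.range (k + 1), ι i = -1 ∧
      ∑ i ∈ Finset.range (k + 1), ι i * c i = (maxSignedSum c k).2) := by
  induction k with
  | zero =>
    exact ⟨⟨fun _ => 1, by simp, by simp, by simp [maxSignedSum]⟩,
      ⟨fun _ => -1, by simp, by simp, by simp [maxSignedSum]⟩⟩
  | succ k ih =>
    have extend (a x s : ℝ) (hs : s = 1 ∨ s = -1)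
        (h : ∃ ι : ℕ → ℝ, (∀ i, ι i = 1 ∨ ι i = -1) ∧ ∏ i ∈ Finset.range (k + 1), ι i = a ∧
          ∑ i ∈ Finset.range (k + 1), ι i * c i = x) :
        ∃ ι : ℕ → ℝ, (∀ i, ι i = 1 ∨ ι i = -1) ∧ ∏ i ∈ Finset.range (k + 1 + 1), ι i = a * s ∧
          ∑ i ∈ Finset.range (k + 1 + 1), ι i * c i = x + s * c (k + 1) := by
      obtain ⟨ι, h1, h2, h3⟩ := h
      have hne : ∀ i ∈ Finset.range (k + 1), i ≠ k + 1 := fun i hi => by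
        rw [Finset.mem_range] at hi; omega
      refine ⟨Function.update ι (k + 1) s, fun i => ?_, ?_, ?_⟩
      · rcases eq_or_ne i (k + 1) with rfl | hi
        · simpa using hs
        · simpa [hi] using h1 i
      · rw [Finset.prod_range_succ, Function.update_self, ← h2]
        congr 1
        exact Finset.prod_congr rfl fun i hi => by rw [Function.update_of_ne (hne i hi)]
      · rw [Finset.sum_range_succ, Function.update_self, ← h3]
        congr 1
        exact Finset.sum_congr rfl fun i hi => by rw [Function.update_of_ne (hne i hi)]
    obtain ⟨hP, hN⟩ := ih
    simp only [maxSignedSum]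
    constructor
    · rcases max_choice ((maxSignedSum c k).1 + c (k + 1)) ((maxSignedSum c k).2 - c (k + 1))
        with h | h <;> rw [h]
      · simpa using extend _ _ 1 (by simp) hP
      · simpa [sub_eq_add_neg] using extend _ _ (-1) (by simp) hN
    · rcases max_choice ((maxSignedSum c k).2 + c (k + 1)) ((maxSignedSum c k).1 - c (k + 1))
        with h | h <;> rw [h]
      · simpa using extend _ _ 1 (by simp) hN
      · simpa [sub_eq_add_neg] using extend _ _ (-1) (by simp) hP

/-- If the pairs of a triangle satisfy the pair bounds and the triangle inequalities, the third
variable has a conditional expectation given the other two, written here as a polynomial. -/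
lemma exists_conditional_expectation {a b u d c e : ℝ}
    (hab : PairBound a b e) (hbu : PairBound b u c) (hau : PairBound a u d)
    (h1 : c + d - 1 ≤ e) (h2 : -(c + d) - 1 ≤ e) (h3 : e ≤ 1 - (c - d)) (h4 : e ≤ 1 + (c - d)) :
    ∃ α β γ δ : ℝ,
      (∀ x y : ℝ, (x = 1 ∨ x = -1) → (y = 1 ∨ y = -1) →
        |α + β * x + γ * y + δ * (x * y)| ≤ 1) ∧
      α + β * a + γ * b + δ * e = u ∧
      α * a + β + γ * e + δ * b = d ∧
      α * b + β * e + γ + δ * a = c := by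
  rw [pairBound_iff] at hab hbu hau
  obtain ⟨q1, q2, q3, q4⟩ := hab
  obtain ⟨r1, r2, r3, r4⟩ := hbu
  obtain ⟨t1, t2, t3, t4⟩ := hau
  obtain ⟨w, w1, w2, w3, w4, w5, w6, w7, w8⟩ : ∃ w : ℝ,
      -(1 + a + b + e) ≤ u + d + c + w ∧ u + d + c + w ≤ 1 + a + b + e ∧
      -(1 + a - b - e) ≤ u + d - c - w ∧ u + d - c - w ≤ 1 + a - b - e ∧
      -(1 - a + b - e) ≤ u - d + c - w ∧ u - d + c - w ≤ 1 - a + b - e ∧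
      -(1 - a - b + e) ≤ u - d - c + w ∧ u - d - c + w ≤ 1 - a - b + e := by
    have hl1 := le_max_left (max (-(1 + a + b + e) - (u + d + c)) (u + d - c - (1 + a - b - e)))
      (max (u - d + c - (1 - a + b - e)) (-(1 - a - b + e) - (u - d - c)))
    have hl2 := le_max_right (max (-(1 + a + b + e) - (u + d + c)) (u + d - c - (1 + a - b - e)))
      (max (u - d + c - (1 - a + b - e)) (-(1 - a - b + e) - (u - d - c)))
    have hl3 := max_le_iff.1 hl1
    have hl4 := max_le_iff.1 hl2
    refine ⟨max (max (-(1 + a + b + e) - (u + d + c)) (u + d - c - (1 + a - b - e)))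
      (max (u - d + c - (1 - a + b - e)) (-(1 - a - b + e) - (u - d - c))),
      by linarith, ?_, ?_, by linarith, ?_, by linarith, by linarith, ?_⟩
    · rw [← le_sub_iff_add_le']
      refine max_le (max_le ?_ ?_) (max_le ?_ ?_) <;> linarith
    · rw [le_sub_comm]
      refine max_le (max_le ?_ ?_) (max_le ?_ ?_) <;> linarith
    · rw [le_sub_comm]
      refine max_le (max_le ?_ ?_) (max_le ?_ ?_) <;> linarith
    · rw [← le_sub_iff_add_le']
      refine max_le (max_le ?_ ?_) (max_le ?_ ?_) <;> linarith
  have quot (q g : ℝ) (hl : -q ≤ g) (hu : g ≤ q) : ∃ h : ℝ, |h| ≤ 1 ∧ q * h = g := by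
    rcases eq_or_ne q 0 with rfl | hq
    · exact ⟨0, by simp, by linarith⟩
    · have hq' : 0 < q := lt_of_le_of_ne (by linarith) hq.symm
      refine ⟨g / q, ?_, by field_simp⟩
      rw [abs_div, abs_of_pos hq', div_le_one hq', abs_le]
      exact ⟨hl, hu⟩
  obtain ⟨k1, b1, e1⟩ := quot _ _ w1 w2
  obtain ⟨k2, b2, e2⟩ := quot _ _ w3 w4
  obtain ⟨k3, b3, e3⟩ := quot _ _ w5 w6
  obtain ⟨k4, b4, e4⟩ := quot _ _ w7 w8
  refine ⟨(k1 + k2 + k3 + k4) / 4, (k1 + k2 - k3 - k4) / 4, (k1 - k2 + k3 - k4) / 4,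
    (k1 - k2 - k3 + k4) / 4, ?_, ?_, ?_, ?_⟩
  · rintro x y (rfl | rfl) (rfl | rfl)
    · convert b1 using 2; ring
    · convert b2 using 2; ring
    · convert b3 using 2; ring
    · convert b4 using 2; ring
  · linear_combination (e1 + e2 + e3 + e4) / 4
  · linear_combination (e1 + e2 - e3 - e4) / 4
  · linear_combination (e1 - e2 + e3 - e4) / 4

lemma hasPathModel_one {v c : ℕ → ℝ} (h : PairBound (v 0) (v 1) (c 0)) :
    HasPathModel 1 v c (c 0) := by
  rw [pairBound_iff] at h
  obtain ⟨h1, h2, h3, h4⟩ := h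
  let sgn : Bool → ℝ := fun b => if b then 1 else -1
  refine ⟨Bool × Bool, inferInstance,
    fun ω => (1 + sgn ω.1 * v 0 + sgn ω.2 * v 1 + sgn ω.1 * sgn ω.2 * c 0) / 4,
    fun i ω => if i = 0 then sgn ω.1 else sgn ω.2, ?_, ?_, ?_, ?_, ?_, ?_⟩
  · rintro ⟨_ | _, _ | _⟩ <;> simp [sgn] <;> linarith
  · simp [Fintype.sum_prod_type, sgn]; ring
  · rintro i ⟨_ | _, _ | _⟩ <;> by_cases hi : i = 0 <;> simp [sgn, hi]
  · intro i hi
    interval_cases i <;> simp [Fintype.sum_prod_type, sgn] <;> ring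
  · intro i hi
    interval_cases i
    simp [Fintype.sum_prod_type, sgn]; ring
  · simp [Fintype.sum_prod_type, sgn]; ring

lemma HasPathModel.succ {k : ℕ} {v c : ℕ → ℝ} {d e : ℝ} (h : HasPathModel k v c e)
    (hab : PairBound (v 0) (v k) e) (hbu : PairBound (v k) (v (k + 1)) (c k))
    (hau : PairBound (v 0) (v (k + 1)) d)
    (h1 : c k + d - 1 ≤ e) (h2 : -(c k + d) - 1 ≤ e)
    (h3 : e ≤ 1 - (c k - d)) (h4 : e ≤ 1 + (c k - d)) :
    HasPathModel (k + 1) v c d := by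
  obtain ⟨α, β, γ, δ, hb, hu, hd, hc⟩ := exists_conditional_expectation hab hbu hau h1 h2 h3 h4
  obtain ⟨Ω, _, p, X, hp, hsum, hX, hv, hcor, he⟩ := h
  let H : Ω → ℝ := fun ω => α + β * X 0 ω + γ * X k ω + δ * (X 0 ω * X k ω)
  have hH (ω : Ω) : |H ω| ≤ 1 := hb _ _ (hX 0 ω) (hX k ω)
  have sq (i : ℕ) (ω : Ω) : X i ω * X i ω = 1 := by
    rcases hX i ω with h | h <;> rw [h] <;> norm_num
  let sgn : Bool → ℝ := fun b => if b then 1 else -1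
  let p' : Ω × Bool → ℝ := fun z => p z.1 * ((1 + sgn z.2 * H z.1) / 2)
  let X' : ℕ → Ω × Bool → ℝ := fun i z => if i = k + 1 then sgn z.2 else X i z.1
  have old (f : Ω → ℝ) : ∑ z, p' z * f z.1 = ∑ ω, p ω * f ω := by
    rw [Fintype.sum_prod_type]
    refine Finset.sum_congr rfl fun ω _ => ?_
    simp [p', sgn]; ring
  have new (f : Ω → ℝ) : ∑ z, p' z * (f z.1 * sgn z.2) = ∑ ω, p ω * (f ω * H ω) := by
    rw [Fintype.sum_prod_type]
    refine Finset.sum_congr rfl fun ω _ => ?_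
    simp [p', sgn]; ring
  have expand (f : Ω → ℝ) : ∑ ω, p ω * (f ω * H ω) = α * ∑ ω, p ω * f ω +
      β * ∑ ω, p ω * (f ω * X 0 ω) + γ * ∑ ω, p ω * (f ω * X k ω) +
      δ * ∑ ω, p ω * (f ω * (X 0 ω * X k ω)) := by
    simp only [Finset.mul_sum, ← Finset.sum_add_distrib]
    refine Finset.sum_congr rfl fun ω _ => ?_
    simp only [H]; ring
  have hold (i : ℕ) (hi : i ≤ k) : X' i = fun z => X i z.1 := by
    funext z
    simp only [X']
    rw [if_neg (by omega)]
  have hnew : X' (k + 1) = fun z => sgn z.2 := by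
    funext z
    simp [X']
  have hv0 := hv 0 (Nat.zero_le _)
  have hvk := hv k le_rfl
  refine ⟨Ω × Bool, inferInstance, p', X', ?_, ?_, ?_, ?_, ?_, ?_⟩
  · rintro ⟨ω, b⟩
    have := abs_le.1 (hH ω)
    refine mul_nonneg (hp ω) ?_
    cases b <;> simp [sgn] <;> linarith
  · simpa [hsum] using old fun _ => 1
  · rintro i ⟨ω, b⟩
    by_cases hi : i = k + 1
    · cases b <;> simp [X', hi, sgn]
    · simpa [X', hi] using hX i ω
  · intro i hi
    rcases Nat.lt_or_eq_of_le hi with hi | rfl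
    · rw [hold i (by omega), old, hv i (by omega)]
    · have := new fun _ => 1
      rw [expand] at this
      simp only [one_mul, mul_one] at this
      rw [hnew, this, hsum, hv0, hvk, he, ← hu, mul_one]
  · intro i hi
    rcases Nat.lt_or_eq_of_le (Nat.le_of_lt_succ hi) with hi | rfl
    · rw [hold i (by omega), hold (i + 1) (by omega), old fun ω => X i ω * X (i + 1) ω, hcor i hi]
    · have := new (X i)
      rw [expand] at this
      have g1 (ω : Ω) : X i ω * X 0 ω = X 0 ω * X i ω := mul_comm _ _
      have g2 (ω : Ω) : X i ω * (X 0 ω * X i ω) = X 0 ω := by linear_combination X 0 ω * sq i ω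
      simp only [g2, sq, g1, mul_one] at this
      rw [hnew, hold i le_rfl, this, hsum, hv0, hvk, he, ← hc, mul_one]
  · have := new (X 0)
    rw [expand] at this
    have g2 (ω : Ω) : X 0 ω * (X 0 ω * X k ω) = X k ω := by linear_combination X k ω * sq 0 ω
    simp only [g2, sq, mul_one] at this
    rw [hnew, hold 0 (Nat.zero_le _), this, hsum, hv0, hvk, he, ← hd, mul_one]

lemma hasPathModel_of_bounds (k : ℕ) {v c : ℕ → ℝ} {d : ℝ}
    (hc : ∀ i ≤ k, PairBound (v i) (v (i + 1)) (c i)) (hd : PairBound (v 0) (v (k + 1)) d)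
    (hP : (maxSignedSum c k).1 - d ≤ k) (hN : (maxSignedSum c k).2 + d ≤ k) :
    HasPathModel (k + 1) v c d := by
  induction k generalizing d with
  | zero =>
    simp only [maxSignedSum, Nat.cast_zero] at hP hN
    obtain rfl : d = c 0 := by linarith
    exact hasPathModel_one (hc 0 le_rfl)
  | succ k ih =>
    have hc' : ∀ i ≤ k, PairBound (v i) (v (i + 1)) (c i) := fun i hi => hc i (by omega)
    obtain ⟨m1, m2, m3⟩ := maxSignedSum_bounds hc'
    have hk := hc (k + 1) le_rfl
    have hlast := hc k (by omega)
    have hk' := pairBound_iff.1 hk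
    have hd' := pairBound_iff.1 hd
    simp only [maxSignedSum] at hP hN
    push_cast at hP hN
    obtain ⟨hP1, hP2⟩ := max_le_iff.1 (sub_le_iff_le_add.1 hP)
    obtain ⟨hN1, hN2⟩ := max_le_iff.1 (le_sub_iff_add_le.2 hN)
    have am1 := le_abs_self (v 0 - v (k + 1))
    have am2 := neg_le_abs (v 0 - v (k + 1))
    have ap1 := le_abs_self (v 0 + v (k + 1))
    have ap2 := neg_le_abs (v 0 + v (k + 1))
    obtain ⟨e, l1, l2, l3, l4, l5, u1, u2, u3, u4, u5⟩ : ∃ e : ℝ,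
        (maxSignedSum c k).1 - k ≤ e ∧ (v 0 + v (k + 1)) - 1 ≤ e ∧ -(v 0 + v (k + 1)) - 1 ≤ e ∧
        c (k + 1) + d - 1 ≤ e ∧ -(c (k + 1) + d) - 1 ≤ e ∧
        e ≤ k - (maxSignedSum c k).2 ∧ e ≤ 1 - (v 0 - v (k + 1)) ∧ e ≤ 1 + (v 0 - v (k + 1)) ∧
        e ≤ 1 - (c (k + 1) - d) ∧ e ≤ 1 + (c (k + 1) - d) := by
      have bv : ∀ i ≤ k + 1, -1 ≤ v i ∧ v i ≤ 1 := fun i hi => by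
        have := pairBound_iff.1 (hc i hi)
        constructor <;> linarith
      have b0 := bv 0 (Nat.zero_le _)
      have b1 := bv (k + 1) le_rfl
      refine ⟨max ((maxSignedSum c k).1 - k) (max
        (max (v 0 + v (k + 1) - 1) (-(v 0 + v (k + 1)) - 1))
        (max (c (k + 1) + d - 1) (-(c (k + 1) + d) - 1))),
        by simp, by simp, by simp, by simp, by simp, ?_, ?_, ?_, ?_, ?_⟩ <;>
      refine max_le ?_ (max_le (max_le ?_ ?_) (max_le ?_ ?_)) <;> linarith
    have he : PairBound (v 0) (v (k + 1)) e := by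
      rw [pairBound_iff]
      refine ⟨?_, ?_, ?_, ?_⟩ <;> linarith
    exact (ih hc' he (by linarith) (by linarith)).succ he hk hd l4 l5 u4 u5

/-! ### Sign vectors -/

lemma bddAbove_signed_sums {k : ℕ} (x : Fin k → ℝ) :
    BddAbove {y | ∃ ι : Fin k → ℝ, (∀ i, ι i = 1 ∨ ι i = -1) ∧ (∏ i, ι i) = -1 ∧
      y = ∑ i, ι i * x i} := by
  refine ⟨∑ i, |x i|, ?_⟩
  rintro y ⟨ι, h, -, rfl⟩
  refine Finset.sum_le_sum fun i _ => ?_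
  rcases h i with h | h <;> rw [h]
  · simpa using le_abs_self (x i)
  · simpa using neg_le_abs (x i)

lemma sum_le_of_prod_eq_neg_one {n : ℕ} {y : Fin n → ℝ} (hy : ∀ i, y i = 1 ∨ y i = -1)
    (hprod : ∏ i, y i = -1) : ∑ i, y i ≤ (n : ℝ) - 2 := by
  obtain ⟨j, hj⟩ : ∃ j, y j = -1 := by
    by_contra! h
    have : ∏ i, y i = 1 := Finset.prod_eq_one fun i _ => (hy i).resolve_right (h i)
    linarith
  have h1 : ∀ i, 0 ≤ 1 - y i := fun i => by rcases hy i with h | h <;> rw [h] <;> norm_num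
  have h2 := Finset.single_le_sum (fun i _ => h1 i) (Finset.mem_univ j)
  rw [Finset.sum_sub_distrib, hj] at h2
  simp at h2
  linarith

lemma bijective_cyclic_succ {n : ℕ} (hn : 0 < n) :
    Function.Bijective fun i : Fin n => (⟨((i : ℕ) + 1) % n, Nat.mod_lt _ hn⟩ : Fin n) := by
  rw [← Finite.injective_iff_bijective]
  intro i j h
  have h' : (i : ℕ) + 1 ≡ j + 1 [MOD n] := congrArg Fin.val h
  have := Nat.ModEq.add_right_cancel' 1 h'
  exact Fin.ext (Nat.ModEq.eq_of_lt_of_lt this i.2 j.2)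

lemma IsSignProb.ae_sign {n : ℕ} {μ : Measure (Fin n → ℝ)} (hμ : IsSignProb μ) :
    ∀ᵐ A ∂μ, ∀ i, A i = 1 ∨ A i = -1 := hμ.2

lemma IsSignProb.integrable_eval {n : ℕ} {μ : Measure (Fin n → ℝ)} (hμ : IsSignProb μ)
    (i : Fin n) : Integrable (fun A => A i) μ := by
  have := hμ.1
  refine Integrable.of_bound (measurable_pi_apply i).aestronglyMeasurable 1 ?_
  filter_upwards [hμ.ae_sign] with A hA
  rcases hA i with h | h <;> rw [h] <;> simp

lemma IsSignProb.integrable_mul {n : ℕ} {μ : Measure (Fin n → ℝ)} (hμ : IsSignProb μ)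
    (i j : Fin n) : Integrable (fun A => A i * A j) μ := by
  have := hμ.1
  refine Integrable.of_bound
    ((measurable_pi_apply i).mul (measurable_pi_apply j)).aestronglyMeasurable 1 ?_
  filter_upwards [hμ.ae_sign] with A hA
  rcases hA i with h | h <;> rcases hA j with h' | h' <;> rw [h, h'] <;> simp

lemma IsSignProb.pairBound {n : ℕ} {μ : Measure (Fin n → ℝ)} (hμ : IsSignProb μ) (i j : Fin n) :
    PairBound (∫ A, A i ∂μ) (∫ A, A j ∂μ) (∫ A, A i * A j ∂μ) := by
  have := hμ.1
  have key (s t : ℝ) (hs : s = 1 ∨ s = -1) (ht : t = 1 ∨ t = -1) :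
      0 ≤ 1 + s * (∫ A, A i ∂μ) + t * (∫ A, A j ∂μ) + s * t * ∫ A, A i * A j ∂μ := by
    have h : 0 ≤ ∫ A, (1 + s * A i + t * A j + s * t * (A i * A j)) ∂μ := by
      refine integral_nonneg_of_ae ?_
      filter_upwards [hμ.ae_sign] with A hA
      rcases hA i with h | h <;> rcases hA j with h' | h' <;> rcases hs with rfl | rfl <;>
        rcases ht with rfl | rfl <;> simp [h, h'] <;> norm_num
    have i1 := (hμ.integrable_eval i).const_mul s
    have i2 := (hμ.integrable_eval j).const_mul t
    have i3 := (hμ.integrable_mul i j).const_mul (s * t)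
    have i0 : Integrable (fun _ : Fin n → ℝ => (1 : ℝ)) μ := integrable_const 1
    have i01 : Integrable (fun A : Fin n → ℝ => 1 + s * A i) μ := i0.add i1
    have i012 : Integrable (fun A : Fin n → ℝ => 1 + s * A i + t * A j) μ := i01.add i2
    rw [integral_add i012 i3, integral_add i01 i2, integral_add i0 i1,
      integral_const_mul, integral_const_mul, integral_const_mul] at h
    simpa using h
  have k1 := key 1 1 (by simp) (by simp)
  have k2 := key 1 (-1) (by simp) (by simp)
  have k3 := key (-1) 1 (by simp) (by simp)
  have k4 := key (-1) (-1) (by simp) (by simp)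
  rw [pairBound_iff]
  refine ⟨?_, ?_, ?_, ?_⟩ <;> linarith

lemma IsSignProb.sum_le {n : ℕ} {μ : Measure (Fin n → ℝ)} (hμ : IsSignProb μ)
    {σ : Fin n → Fin n} (hσ : Function.Bijective σ) {ι : Fin n → ℝ}
    (hι : ∀ i, ι i = 1 ∨ ι i = -1) (hprod : ∏ i, ι i = -1) :
    ∑ i, ι i * ∫ A, A i * A (σ i) ∂μ ≤ (n : ℝ) - 2 := by
  have := hμ.1
  have hintegral (i : Fin n) : Integrable (fun A => ι i * (A i * A (σ i))) μ :=
    (hμ.integrable_mul i (σ i)).const_mul (ι i)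
  calc ∑ i, ι i * ∫ A, A i * A (σ i) ∂μ = ∫ A, ∑ i, ι i * (A i * A (σ i)) ∂μ := by
        rw [integral_finsetSum _ fun i _ => hintegral i]
        simp only [integral_const_mul]
    _ ≤ ∫ _, ((n : ℝ) - 2) ∂μ := by
        refine integral_mono_ae (integrable_finsetSum _ fun i _ => hintegral i) (integrable_const _) ?_
        filter_upwards [hμ.ae_sign] with A hA
        refine sum_le_of_prod_eq_neg_one (fun i => ?_) ?_
        · rcases hι i with h | h <;> rcases hA i with h' | h' <;> rcases hA (σ i) with h'' | h'' <;>
            simp [h, h', h'']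
        · have hsq : (∏ i, A i) * ∏ i, A i = 1 := by
            rw [← Finset.prod_mul_distrib]
            refine Finset.prod_eq_one fun i _ => ?_
            rcases hA i with h | h <;> rw [h] <;> norm_num
          rw [Finset.prod_mul_distrib, Finset.prod_mul_distrib, hσ.prod_comp A, hsq, hprod, mul_one]
    _ = (n : ℝ) - 2 := by simp

lemma exists_isSignProb_of_weights {n : ℕ} {Ω : Type} [Fintype Ω] {p : Ω → ℝ}
    {X : Ω → Fin n → ℝ} (hp : ∀ ω, 0 ≤ p ω) (hsum : ∑ ω, p ω = 1)
    (hX : ∀ ω i, X ω i = 1 ∨ X ω i = -1) :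
    ∃ μ : Measure (Fin n → ℝ), IsSignProb μ ∧
      ∀ f : (Fin n → ℝ) → ℝ, ∫ A, f A ∂μ = ∑ ω, p ω * f (X ω) := by
  refine ⟨∑ ω, ENNReal.ofReal (p ω) • Measure.dirac (X ω), ⟨⟨?_⟩, ?_⟩, fun f => ?_⟩
  · simp [Measure.finsetSum_apply, ← ENNReal.ofReal_sum_of_nonneg fun ω _ => hp ω, hsum]
  · rw [Measure.finsetSum_apply]
    refine Finset.sum_eq_zero fun ω _ => ?_
    rw [Measure.smul_apply, Measure.dirac_apply, Set.indicator_of_notMem, smul_zero]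
    exact fun h => h (hX ω)
  · rw [integral_finsetSum_measure]
    · refine Finset.sum_congr rfl fun ω _ => ?_
      rw [integral_smul_measure, integral_dirac, ENNReal.toReal_ofReal (hp ω), smul_eq_mul]
    · intro ω _
      exact (integrable_dirac (by simp)).smul_measure ENNReal.ofReal_ne_top

theorem stmt7 (n : ℕ) (hn : 3 ≤ n) (v c : Fin n → ℝ) :
    (∃ μ : Measure (Fin n → ℝ), IsSignProb μ ∧
        (∀ i : Fin n, (∫ A, A i ∂μ) = v i) ∧
        (∀ i : Fin n,
          (∫ A, A i * A ⟨((i : ℕ) + 1) % n, Nat.mod_lt _ (by omega)⟩ ∂μ) = c i)) ↔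
      (∀ i : Fin n,
          (-1 ≤ v i ∧ v i ≤ 1) ∧
          |v i + v ⟨((i : ℕ) + 1) % n, Nat.mod_lt _ (by omega)⟩| - 1 ≤ c i ∧
          c i ≤ 1 - |v i - v ⟨((i : ℕ) + 1) % n, Nat.mod_lt _ (by omega)⟩|) ∧
        s1 c ≤ (n : ℝ) - 2 := by
  have hn' : (3 : ℝ) ≤ n := by exact_mod_cast hn
  constructor
  · rintro ⟨μ, hμ, hv, hc⟩
    refine ⟨fun i => ?_, ?_⟩
    · have h := hμ.pairBound i ⟨((i : ℕ) + 1) % n, Nat.mod_lt _ (by omega)⟩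
      rw [hv, hv, hc] at h
      have h' := pairBound_iff.1 h
      exact ⟨⟨by linarith, by linarith⟩, h⟩
    · refine Real.sSup_le ?_ (by linarith)
      rintro y ⟨ι, hι, hprod, rfl⟩
      have h := hμ.sum_le (bijective_cyclic_succ (by omega)) hι hprod
      simpa only [hc] using h
  · rintro ⟨hpair, hs⟩
    obtain ⟨k, rfl⟩ : ∃ k, n = k + 2 := ⟨n - 2, by omega⟩
    let V : ℕ → ℝ := fun i => if h : i < k + 2 then v ⟨i, h⟩ else 0
    let C : ℕ → ℝ := fun i => if h : i < k + 2 then c ⟨i, h⟩ else 0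
    have hV (i : ℕ) (h : i < k + 2) : V i = v ⟨i, h⟩ := dif_pos h
    have hC (i : ℕ) (h : i < k + 2) : C i = c ⟨i, h⟩ := dif_pos h
    have hedge (i : ℕ) (hi : i ≤ k) : PairBound (V i) (V (i + 1)) (C i) := by
      have h := (hpair ⟨i, by omega⟩).2
      simp only [Nat.mod_eq_of_lt (show i + 1 < k + 2 by omega)] at h
      rwa [hV i (by omega), hV (i + 1) (by omega), hC i (by omega)]
    have hclose : PairBound (V 0) (V (k + 1)) (C (k + 1)) := by
      have h := (hpair ⟨k + 1, by omega⟩).2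
      simp only [Nat.mod_self, show k + 1 + 1 = k + 2 from rfl] at h
      rw [hV 0 (by omega), hV (k + 1) (by omega), hC (k + 1) (by omega), PairBound, abs_sub_comm,
        add_comm]
      exact h
    have hsigns (ι : ℕ → ℝ) (s : ℝ) (hι : ∀ i, ι i = 1 ∨ ι i = -1) (hs' : s = 1 ∨ s = -1)
        (hprod : (∏ i ∈ Finset.range (k + 1), ι i) * s = -1) :
        ∑ i ∈ Finset.range (k + 1), ι i * C i + s * C (k + 1) ≤ k := by
      have hle : ∑ i ∈ Finset.range (k + 1), ι i * C i + s * C (k + 1) ≤ s1 c := by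
        refine le_csSup (bddAbove_signed_sums c)
          ⟨Fin.snoc (fun i : Fin (k + 1) => ι i) s, fun i => ?_, ?_, ?_⟩
        · refine Fin.lastCases ?_ (fun i => ?_) i
          · simpa using hs'
          · simpa using hι i
        · rw [Fin.prod_univ_castSucc, ← hprod, Finset.prod_range]
          simp
        · rw [Fin.sum_univ_castSucc, Finset.sum_range, hC (k + 1) (by omega)]
          simp only [Fin.snoc_castSucc, Fin.snoc_last]
          congr 1
          exact Finset.sum_congr rfl fun i _ => by rw [hC i (by omega)]; rfl
      push_cast at hs
      linarith
    obtain ⟨⟨ι, hι, hιp, hιs⟩, κ, hκ, hκp, hκs⟩ := exists_signs_eq_maxSignedSum C k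
    have hP := hsigns ι (-1) hι (by simp) (by rw [hιp]; norm_num)
    have hN := hsigns κ 1 hκ (by simp) (by rw [hκp]; norm_num)
    rw [hιs] at hP
    rw [hκs] at hN
    obtain ⟨Ω, _, p, X, hp, hsum, hX, hmean, hcor, hend⟩ :=
      hasPathModel_of_bounds k hedge hclose (by linarith) (by linarith)
    obtain ⟨μ, hμ, hintegral⟩ := exists_isSignProb_of_weights (n := k + 2)
      (X := fun ω i => X i ω) hp hsum fun ω i => hX i ω
    refine ⟨μ, hμ, fun i => ?_, fun i => ?_⟩
    · rw [hintegral fun A => A i, hmean i (by omega), hV i i.2]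
    · rw [hintegral fun A => A i * A ⟨((i : ℕ) + 1) % (k + 2), Nat.mod_lt _ (by omega)⟩]
      rcases Nat.lt_or_eq_of_le (Nat.le_of_lt_succ i.2) with hi | hi
      · simp only [Nat.mod_eq_of_lt (show (i : ℕ) + 1 < k + 2 by omega)]
        rw [hcor i hi, hC i i.2]
      · obtain ⟨i, hik⟩ := i
        obtain rfl : i = k + 1 := hi
        simp only [Nat.mod_self, show k + 1 + 1 = k + 2 from rfl]
        rw [← hC (k + 1) (by omega), ← hend]
        exact Finset.sum_congr rfl fun ω _ => by ring
end

section
/- Let n ≥ 2 and let c₁,…,cₙ ∈ [−1,1]. Then s₁(c₁, …, cₙ, 1, 1, …, 1) ≤ 2n − 2 (with n arguments equal to 1) if and only if s₁(c₁,…,cₙ) ≤ n − 2. -/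
/-- `s₀(x₁,…,xₖ)`: the maximum of `∑ ιᵢ xᵢ` over sign vectors `ι ∈ {−1,1}ᵏ`
with an even number of `−1`'s (equivalently, `∏ ιᵢ = 1`). -/
noncomputable def s0 {k : ℕ} (x : Fin k → ℝ) : ℝ :=
  sSup {y | ∃ ι : Fin k → ℝ, (∀ i, ι i = 1 ∨ ι i = -1) ∧ (∏ i, ι i) = 1 ∧ y = ∑ i, ι i * x i}


lemma s1_le_iff {k : ℕ} (hk : 0 < k) (x : Fin k → ℝ) (b : ℝ) :
    s1 x ≤ b ↔ ∀ ι : Fin k → ℝ, (∀ i, ι i = 1 ∨ ι i = -1) → (∏ i, ι i) = -1 →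
      ∑ i, ι i * x i ≤ b := by
  have hbdd : BddAbove {y | ∃ ι : Fin k → ℝ, (∀ i, ι i = 1 ∨ ι i = -1) ∧ (∏ i, ι i) = -1 ∧
      y = ∑ i, ι i * x i} := by
    refine ⟨∑ i, |x i|, ?_⟩
    rintro _ ⟨ι, hι, -, rfl⟩
    refine Finset.sum_le_sum fun i _ => ?_
    rcases hι i with h | h
    · simpa [h] using le_abs_self (x i)
    · simpa [h] using neg_le_abs (x i)
  constructor
  · intro h ι hι hp
    exact (le_csSup hbdd ⟨ι, hι, hp, rfl⟩).trans h
  · intro h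
    refine csSup_le ?_ ?_
    · refine ⟨_, fun i => if i = ⟨0, hk⟩ then -1 else 1, fun i => ?_, ?_, rfl⟩
      · by_cases hi : i = ⟨0, hk⟩ <;> simp [hi]
      · simp
    · rintro _ ⟨ι, hι, hp, rfl⟩
      exact h ι hι hp

lemma prod_eq_one_or_neg_one {k : ℕ} (ι : Fin k → ℝ) (hι : ∀ i, ι i = 1 ∨ ι i = -1) :
    (∏ i, ι i) = 1 ∨ (∏ i, ι i) = -1 := by
  refine Finset.prod_induction ι (fun a => a = 1 ∨ a = -1) ?_ (Or.inl rfl) fun i _ => hι i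
  rintro a b (rfl | rfl) (rfl | rfl) <;> simp

lemma sum_le_sub_two_of_prod_eq_neg_one {k : ℕ} (ι : Fin k → ℝ)
    (hι : ∀ i, ι i = 1 ∨ ι i = -1) (hp : (∏ i, ι i) = -1) :
    ∑ i, ι i ≤ (k : ℝ) - 2 := by
  obtain ⟨j, hj⟩ : ∃ j, ι j = -1 := by
    by_contra! h
    have : (∏ i, ι i) = 1 := Finset.prod_eq_one fun i _ => (hι i).resolve_right (h i)
    linarith
  have hnonneg : ∀ i ∈ Finset.univ, 0 ≤ 1 - ι i := fun i _ => by
    rcases hι i with h | h <;> rw [h] <;> norm_num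
  have hle := Finset.single_le_sum hnonneg (Finset.mem_univ j)
  simp only [Finset.sum_sub_distrib, hj, Finset.sum_const, Finset.card_univ, Fintype.card_fin,
    nsmul_eq_mul, mul_one] at hle
  linarith

lemma sum_sign_mul_le {k : ℕ} (ι x : Fin k → ℝ) (hι : ∀ i, ι i = 1 ∨ ι i = -1)
    (hx : ∀ i, -1 ≤ x i ∧ x i ≤ 1) : ∑ i, ι i * x i ≤ (k : ℝ) := by
  have h : ∑ i, ι i * x i ≤ ∑ _i : Fin k, (1 : ℝ) := Finset.sum_le_sum fun i _ => by
    rcases hι i with h | h <;> rw [h] <;> linarith [hx i]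
  simpa using h

theorem stmt10 (n : ℕ) (hn : 2 ≤ n) (c : Fin n → ℝ)
    (hc : ∀ i, -1 ≤ c i ∧ c i ≤ 1) :
    s1 (Fin.append c (fun _ : Fin n => (1 : ℝ))) ≤ 2 * (n : ℝ) - 2 ↔
      s1 c ≤ (n : ℝ) - 2 := by
  rw [s1_le_iff (by omega), s1_le_iff (by omega)]
  constructor
  · intro h ι hι hp
    have h' := h (Fin.append ι fun _ => 1) (fun i => by
      refine Fin.addCases (fun i => ?_) (fun i => ?_) i
      · simpa using hι i
      · exact Or.inl (Fin.append_right ..))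
      (by simp only [Fin.prod_univ_add, Fin.append_left, Fin.append_right, hp,
        Finset.prod_const_one, mul_one])
    simp only [Fin.sum_univ_add, Fin.append_left, Fin.append_right, mul_one, Finset.sum_const,
      Finset.card_univ, Fintype.card_fin, nsmul_eq_mul] at h'
    linarith
  · intro h κ hκ hp
    rw [Fin.prod_univ_add] at hp
    simp only [Fin.sum_univ_add, Fin.append_left, Fin.append_right]
    have hl : ∀ i : Fin n, κ (Fin.castAdd n i) = 1 ∨ κ (Fin.castAdd n i) = -1 := fun i => hκ _
    have hr : ∀ i : Fin n, κ (Fin.natAdd n i) = 1 ∨ κ (Fin.natAdd n i) = -1 := fun i => hκ _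
    rcases prod_eq_one_or_neg_one _ hr with hpr | hpr
    · rw [hpr, mul_one] at hp
      have h₁ := h _ hl hp
      have h₂ := sum_sign_mul_le _ (fun _ => 1) hr fun _ => by norm_num
      linarith
    · have h₁ := sum_sign_mul_le _ c hl hc
      have h₂ := sum_le_sub_two_of_prod_eq_neg_one _ hr hpr
      simp only [mul_one]
      linarith
end
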